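/- Let (X,d,μ) be a complete doubling metric measure space, let X_α ⊆ X be measurable with μ(X_α) > 0, and let x^1,…,x^N be bounded Lipschitz functions on X_α. Let D be a derivation on (X_α,d,μ|_{X_α}) and f a bounded Lipschitz function on X_α, and suppose there exist measurable μ-essentially bounded functions a_1,…,a_N : X_α → ℝ such that Lip(f − Σ_{j=1}^N a_j(z)·x^j)(z) = 0 for μ-a.e. z ∈ X_α (where for fixed z one applies Lip to the function y ↦ f(y) − Σ_j a_j(z)·x^j(y)). Then Df(z) = Σ_{j=1}^N a_j(z)·(D x^j)(z) for μ-a.e. z ∈ X_α. -/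

import Mathlib

open MeasureTheory Metric Filter Set Topology
open scoped ENNReal NNReal

noncomputable section

/-- `f` is a bounded Lipschitz function. -/
def IsBddLipschitz {X : Type*} [PseudoMetricSpace X] (f : X → ℝ) : Prop :=
  (∃ K : ℝ≥0, LipschitzWith K f) ∧ ∃ M : ℝ, ∀ x, |f x| ≤ M

/-- The global Lipschitz constant of `f`. -/
def glip {X : Type*} [PseudoMetricSpace X] (f : X → ℝ) : ℝ :=
  sInf {K : ℝ | 0 ≤ K ∧ ∀ x y, |f x - f y| ≤ K * dist x y}

/-- `max (sup_X |f|) (global Lipschitz constant of f)`. -/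
def lipNorm {X : Type*} [PseudoMetricSpace X] (f : X → ℝ) : ℝ :=
  max (⨆ x, |f x|) (glip f)

/-- The variation of `f` on the open ball `B(x,r)`:
`varlip f x r = r⁻¹ · sup_{y ∈ B(x,r)} |f x - f y|`. -/
def varlip {X : Type*} [PseudoMetricSpace X] (f : X → ℝ) (x : X) (r : ℝ) : ℝ :=
  r⁻¹ * sSup ((fun y => |f x - f y|) '' ball x r)

/-- The upper variation of `f` at `x` from scale `r` down to `0`:
`Lip f (x,r) = sup_{0 < s ≤ r} varlip f x s`. -/
def bigLipR {X : Type*} [PseudoMetricSpace X] (f : X → ℝ) (x : X) (r : ℝ) : ℝ :=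
  ⨆ s : Ioc (0:ℝ) r, varlip f x s.1

/-- The lower variation of `f` at `x` from scale `r` down to `0`:
`lip f (x,r) = inf_{0 < s ≤ r} varlip f x s`. -/
def smlLipR {X : Type*} [PseudoMetricSpace X] (f : X → ℝ) (x : X) (r : ℝ) : ℝ :=
  ⨅ s : Ioc (0:ℝ) r, varlip f x s.1

/-- The pointwise upper Lipschitz constant
`Lip f (x) = inf_{r>0} sup_{0<s≤r} varlip f x s`. -/
def bigLip {X : Type*} [PseudoMetricSpace X] (f : X → ℝ) (x : X) : ℝ :=
  ⨅ r : Ioi (0:ℝ), bigLipR f x r.1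

/-- The pointwise lower Lipschitz constant
`lip f (x) = sup_{r>0} inf_{0<s≤r} varlip f x s`. -/
def smlLip {X : Type*} [PseudoMetricSpace X] (f : X → ℝ) (x : X) : ℝ :=
  ⨆ r : Ioi (0:ℝ), smlLipR f x r.1

/-- A derivation on the metric measure space `(X,d,μ)`: a linear, bounded operator
from bounded Lipschitz functions to measurable essentially bounded functions that
satisfies the Leibniz rule and is weak* sequentially continuous. -/
structure MDerivation (X : Type*) [PseudoMetricSpace X] [MeasurableSpace X]
    (μ : MeasureTheory.Measure X) where
  D : (X → ℝ) → (X → ℝ)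
  C : ℝ
  C_nonneg : 0 ≤ C
  measurable_D : ∀ f, IsBddLipschitz f → Measurable (D f)
  linear : ∀ (a b : ℝ) (f g : X → ℝ), IsBddLipschitz f → IsBddLipschitz g →
      ∀ᵐ x ∂μ, D (fun y => a * f y + b * g y) x = a * D f x + b * D g x
  bound : ∀ f, IsBddLipschitz f → ∀ᵐ x ∂μ, |D f x| ≤ C * lipNorm f
  leibniz : ∀ f g, IsBddLipschitz f → IsBddLipschitz g →
      ∀ᵐ x ∂μ, D (fun y => f y * g y) x = f x * D g x + g x * D f x
  weakStar : ∀ (F : ℕ → X → ℝ) (f : X → ℝ), (∀ n, IsBddLipschitz (F n)) →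
      IsBddLipschitz f → (∃ B : ℝ, ∀ n, lipNorm (F n) ≤ B) →
      (∀ x, Tendsto (fun n => F n x) atTop (𝓝 (f x))) →
      ∀ g : X → ℝ, Integrable g μ →
        Tendsto (fun n => ∫ x, D (F n) x * g x ∂μ) atTop (𝓝 (∫ x, D f x * g x ∂μ))

/-- The restriction of `μ` to a subset `s`, as a measure on the subtype `s`. -/
def subMeasure {X : Type*} [MeasurableSpace X] (μ : MeasureTheory.Measure X) (s : Set X) :
    MeasureTheory.Measure s :=
  MeasureTheory.Measure.comap Subtype.val μ

/-! ### Bounded Lipschitz functions -/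

section BddLipschitz

variable {U : Type*} [PseudoMetricSpace U]

lemma isBddLipschitz_of_bounds {g : U → ℝ} {K : ℝ≥0} {M : ℝ} (hg : LipschitzWith K g)
    (hM : ∀ x, |g x| ≤ M) : IsBddLipschitz g :=
  ⟨⟨K, hg⟩, M, hM⟩

lemma isBddLipschitz_const (c : ℝ) : IsBddLipschitz (fun _ : U => c) :=
  ⟨⟨0, LipschitzWith.const c⟩, |c|, fun _ => le_rfl⟩

lemma IsBddLipschitz.add {f g : U → ℝ} (hf : IsBddLipschitz f) (hg : IsBddLipschitz g) :
    IsBddLipschitz (fun y => f y + g y) := by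
  obtain ⟨⟨K, hK⟩, M, hM⟩ := hf
  obtain ⟨⟨L, hL⟩, B, hB⟩ := hg
  exact ⟨⟨K + L, hK.add hL⟩, M + B, fun x => (abs_add_le _ _).trans (add_le_add (hM x) (hB x))⟩

lemma IsBddLipschitz.const_mul {f : U → ℝ} (hf : IsBddLipschitz f) (c : ℝ) :
    IsBddLipschitz (fun y => c * f y) := by
  obtain ⟨⟨K, hK⟩, M, hM⟩ := hf
  refine ⟨⟨‖c‖₊ * K, LipschitzWith.of_dist_le_mul fun x y => ?_⟩, |c| * M, fun x => ?_⟩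
  · have h := hK.dist_le_mul x y
    rw [Real.dist_eq] at h ⊢
    rw [← mul_sub, abs_mul, NNReal.coe_mul, coe_nnnorm, Real.norm_eq_abs, mul_assoc]
    gcongr
  · rw [abs_mul]
    gcongr
    exact hM x

lemma IsBddLipschitz.sub {f g : U → ℝ} (hf : IsBddLipschitz f) (hg : IsBddLipschitz g) :
    IsBddLipschitz (fun y => f y - g y) := by
  simpa [sub_eq_add_neg] using hf.add (hg.const_mul (-1))

lemma IsBddLipschitz.sum_mul {ι : Type*} (s : Finset ι) {g : ι → U → ℝ}
    (hg : ∀ j, IsBddLipschitz (g j)) (c : ι → ℝ) :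
    IsBddLipschitz (fun y => ∑ j ∈ s, c j * g j y) := by
  classical
  induction s using Finset.induction_on with
  | empty => simpa using isBddLipschitz_const 0
  | insert i s hi ih =>
    simp only [Finset.sum_insert hi]
    exact ((hg i).const_mul _).add ih

lemma lipNorm_le {g : U → ℝ} {K : ℝ≥0} {M : ℝ} (hM0 : 0 ≤ M) (hg : LipschitzWith K g)
    (hM : ∀ x, |g x| ≤ M) : lipNorm g ≤ max M K := by
  refine max_le_max (Real.iSup_le hM hM0) (csInf_le ⟨0, fun k hk => hk.1⟩ ⟨K.2, fun x y => ?_⟩)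
  simpa [Real.dist_eq] using hg.dist_le_mul x y

/-- A Lipschitz function with vanishing pointwise upper Lipschitz constant at `z` varies at most
like `ε · dist` near `z`. -/
lemma exists_radius_of_bigLip_eq_zero {h : U → ℝ} (hh : IsBddLipschitz h) {z : U}
    (hz : bigLip h z = 0) {ε : ℝ} (hε : 0 < ε) :
    ∃ r > 0, ∀ y, dist y z < r → |h z - h y| ≤ ε * dist y z := by
  obtain ⟨⟨K, hK⟩, -⟩ := hh
  have hKd : ∀ y, |h z - h y| ≤ K * dist y z := fun y => by
    simpa [Real.dist_eq, dist_comm] using hK.dist_le_mul z y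
  have hlt : bigLip h z < ε / 2 := by rw [hz]; positivity
  obtain ⟨⟨r, hr⟩, hlt⟩ := exists_lt_of_ciInf_lt hlt
  have hr : 0 < r := hr
  refine ⟨r / 2, by positivity, fun y hy => ?_⟩
  rcases (dist_nonneg : 0 ≤ dist y z).eq_or_lt with h0 | hpos
  · simpa [← h0] using hKd y
  have hbdd : BddAbove (range fun s : Ioc (0 : ℝ) r => varlip h z s.1) := by
    refine ⟨K, ?_⟩
    rintro _ ⟨⟨s, hs⟩, rfl⟩
    refine (inv_mul_le_iff₀ hs.1).2 ?_
    refine csSup_le (image_nonempty.2 ⟨z, mem_ball_self hs.1⟩) ?_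
    rintro _ ⟨w, hw, rfl⟩
    rw [mul_comm]
    exact (hKd w).trans (mul_le_mul_of_nonneg_left (le_of_lt hw) K.2)
  have hs : 2 * dist y z ∈ Ioc (0 : ℝ) r := ⟨by positivity, by linarith⟩
  have hv : varlip h z (2 * dist y z) ≤ ε / 2 := (le_ciSup hbdd ⟨_, hs⟩).trans hlt.le
  rw [varlip, inv_mul_le_iff₀ hs.1] at hv
  have hle : |h z - h y| ≤ sSup ((fun y => |h z - h y|) '' ball z (2 * dist y z)) := by
    refine le_csSup ⟨K * (2 * dist y z), ?_⟩ ⟨y, by rw [mem_ball]; linarith, rfl⟩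
    rintro _ ⟨w, hw, rfl⟩
    exact (hKd w).trans (mul_le_mul_of_nonneg_left (le_of_lt hw) K.2)
  linarith

end BddLipschitz

/-! ### Locality of derivations -/

namespace MDerivation

variable {U : Type*} [PseudoMetricSpace U] [MeasurableSpace U] {ν : Measure U}
  (D : MDerivation U ν)

lemma ae_zero : ∀ᵐ x ∂ν, D.D (fun _ => 0) x = 0 := by
  simpa using D.linear 0 0 _ _ (isBddLipschitz_const 0) (isBddLipschitz_const 0)

lemma ae_const (c : ℝ) : ∀ᵐ x ∂ν, D.D (fun _ => c) x = 0 := by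
  have h1 := D.leibniz _ _ (isBddLipschitz_const 1) (isBddLipschitz_const 1)
  have h2 := D.linear c 0 _ _ (isBddLipschitz_const 1) (isBddLipschitz_const 1)
  filter_upwards [h1, h2] with x h1 h2
  simp only [mul_one, one_mul, zero_mul, add_zero] at h1 h2
  rw [h2, show D.D (fun _ => 1) x = 0 by linarith, mul_zero]

lemma ae_sub {f g : U → ℝ} (hf : IsBddLipschitz f) (hg : IsBddLipschitz g) :
    ∀ᵐ x ∂ν, D.D (fun y => f y - g y) x = D.D f x - D.D g x := by
  simpa [sub_eq_add_neg] using D.linear 1 (-1) f g hf hg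

lemma ae_sum_mul {ι : Type*} (s : Finset ι) {g : ι → U → ℝ} (hg : ∀ j, IsBddLipschitz (g j))
    (c : ι → ℝ) :
    ∀ᵐ x ∂ν, D.D (fun y => ∑ j ∈ s, c j * g j y) x = ∑ j ∈ s, c j * D.D (g j) x := by
  classical
  induction s using Finset.induction_on with
  | empty => simpa using D.ae_zero
  | insert i s hi ih =>
    have h := D.linear (c i) 1 _ _ (hg i) (IsBddLipschitz.sum_mul s hg c)
    filter_upwards [h, ih] with x h ih
    simp only [Finset.sum_insert hi]
    rw [← ih]
    simpa using h

variable [OpensMeasurableSpace U] [SigmaFinite ν]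

/-- Locality: `D u` vanishes almost everywhere on the zero set of `u`. -/
lemma ae_eq_zero_of_eq_zero {u : U → ℝ} (hu : IsBddLipschitz u) :
    ∀ᵐ x ∂ν, u x = 0 → D.D u x = 0 := by
  obtain ⟨⟨K, hK⟩, M, hM⟩ := id hu
  let δ : ℕ → ℝ := fun n => 1 / ((n : ℝ) + 1)
  have hδ0 : ∀ n, 0 < δ n := fun n => Nat.one_div_pos_of_nat
  have hδ1 : ∀ n, δ n ≤ 1 := fun n => by
    rw [div_le_one (by positivity)]; linarith [n.cast_nonneg (α := ℝ)]
  let F : ℕ → U → ℝ := fun n y => u y - max (-δ n) (min (u y) (δ n))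
  let η : ℕ → U → ℝ := fun n y => max 0 (δ n - |u y|)
  have hclamp : ∀ n y, |max (-δ n) (min (u y) (δ n))| ≤ δ n := fun n y => by
    rw [abs_le]
    exact ⟨le_max_left _ _, max_le (by linarith [hδ0 n]) (min_le_right _ _)⟩
  have hFlip : ∀ n, LipschitzWith (K + K) (F n) := fun n =>
    hK.sub ((hK.min_const _).const_max _)
  have hFbd : ∀ n y, |F n y| ≤ M + 1 := fun n y =>
    (abs_sub _ _).trans (add_le_add (hM y) ((hclamp n y).trans (hδ1 n)))
  have hFB : ∀ n, IsBddLipschitz (F n) := fun n => isBddLipschitz_of_bounds (hFlip n) (hFbd n)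
  have hηB : ∀ n, IsBddLipschitz (η n) := fun n => by
    refine isBddLipschitz_of_bounds (K := 0 + 1 * K) (M := δ n)
      (((LipschitzWith.const (δ n)).sub (lipschitzWith_one_norm.comp hK)).const_max 0) fun y => ?_
    rw [abs_of_nonneg (le_max_left _ _)]
    exact max_le (hδ0 n).le (by linarith [abs_nonneg (u y)])
  have hprod : ∀ n, (fun y => η n y * F n y) = fun _ => 0 := fun n => by
    funext y
    rcases le_total |u y| (δ n) with h | h
    · have h' := abs_le.1 h
      simp [F, min_eq_left h'.2, max_eq_right h'.1]
    · simp [η, h]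
  have hDF : ∀ n, ∀ᵐ x ∂ν, u x = 0 → D.D (F n) x = 0 := fun n => by
    have hl := D.leibniz _ _ (hηB n) (hFB n)
    rw [hprod n] at hl
    filter_upwards [hl, D.ae_zero] with x hl h0 hx
    have hF0 : F n x = 0 := by simp [F, hx, (hδ0 n).le]
    have hη0 : η n x = δ n := by simp [η, hx, (hδ0 n).le]
    rw [h0, hF0, hη0, zero_mul, add_zero] at hl
    exact (mul_eq_zero.1 hl.symm).resolve_left (hδ0 n).ne'
  have hlim : ∀ x, Tendsto (fun n => F n x) atTop (𝓝 (u x)) := fun x => by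
    have h0 : Tendsto (fun n => max (-δ n) (min (u x) (δ n))) atTop (𝓝 0) :=
      squeeze_zero_norm (fun n => hclamp n x) tendsto_one_div_add_atTop_nhds_zero_nat
    simpa [F] using tendsto_const_nhds.sub h0
  have hnorm : ∃ B : ℝ, ∀ n, lipNorm (F n) ≤ B := by
    refine ⟨max (|M| + 1) ((K + K : ℝ≥0) : ℝ), fun n => lipNorm_le (by positivity) (hFlip n)
      fun x => (hFbd n x).trans ?_⟩
    linarith [le_abs_self M]
  have hZ : MeasurableSet {x | u x = 0} :=
    hK.continuous.measurable (measurableSet_singleton 0)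
  have hae : ({x | u x = 0}.indicator (D.D u)) =ᵐ[ν] 0 := by
    refine ae_eq_zero_of_forall_setIntegral_eq_of_sigmaFinite (fun s hs hsf => ?_)
      fun s hs hsf => ?_
    · have : IsFiniteMeasure (ν.restrict s) := ⟨by simpa using hsf⟩
      refine Integrable.indicator ?_ hZ
      refine Integrable.of_bound (D.measurable_D u hu).aestronglyMeasurable (D.C * lipNorm u) ?_
      exact ae_restrict_of_ae (D.bound u hu)
    · have hg : Integrable ((s ∩ {x | u x = 0}).indicator (fun _ => (1 : ℝ))) ν :=
        (integrable_indicator_iff (hs.inter hZ)).2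
          (integrableOn_const ((measure_mono inter_subset_left).trans_lt hsf).ne)
      have hw := D.weakStar F u hFB hu hnorm hlim _ hg
      have hz : ∀ n, ∫ x, D.D (F n) x * (s ∩ {x | u x = 0}).indicator (fun _ => (1 : ℝ)) x ∂ν
          = 0 := fun n => by
        refine integral_eq_zero_of_ae ?_
        filter_upwards [hDF n] with x hx
        by_cases hm : x ∈ s ∩ {x | u x = 0}
        · simp [hx hm.2]
        · simp [hm]
      simp only [hz] at hw
      rw [← integral_indicator hs, indicator_indicator]
      refine Eq.trans (integral_congr_ae (Eventually.of_forall fun x => ?_))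
        (tendsto_nhds_unique tendsto_const_nhds hw).symm
      by_cases hm : x ∈ s ∩ {x | u x = 0} <;> simp only [hm, indicator_of_mem,
        indicator_of_notMem, not_false_eq_true, mul_one, mul_zero]
  filter_upwards [hae] with x hx h0
  simpa [h0] using hx

/-- If `h` is `K`-Lipschitz on a set `A` of diameter at most one, then `|D h| ≤ C(D) · K` almost
everywhere on `A`. -/
lemma ae_abs_le_of_lipschitzOn {h : U → ℝ} (hh : IsBddLipschitz h) {A : Set U} {K : ℝ≥0}
    (hA : LipschitzOnWith K h A) (hdiam : ∀ x ∈ A, ∀ y ∈ A, dist x y ≤ 1) :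
    ∀ᵐ x ∂ν, x ∈ A → |D.D h x| ≤ D.C * K := by
  rcases A.eq_empty_or_nonempty with rfl | ⟨p, hp⟩
  · simp
  obtain ⟨g, hg, hgA⟩ := hA.extend_real
  let G : U → ℝ := fun y => max (-(K : ℝ)) (min (g y - h p) K)
  have hGlip : LipschitzWith K G := by
    have h1 : LipschitzWith (K + 0) fun y => g y - h p := hg.sub (LipschitzWith.const (h p))
    rw [add_zero] at h1
    exact (h1.min_const _).const_max _
  have hGbd : ∀ y, |G y| ≤ K := fun y => by
    rw [abs_le]
    exact ⟨le_max_left _ _, max_le (by linarith [K.coe_nonneg]) (min_le_right _ _)⟩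
  have hGB : IsBddLipschitz G := isBddLipschitz_of_bounds hGlip hGbd
  have hGA : ∀ y ∈ A, h y - h p - G y = 0 := fun y hy => by
    have hd := abs_le.1 ((Real.dist_eq _ _ ▸ hA.dist_le_mul y hy p hp).trans
      (mul_le_of_le_one_right K.2 (hdiam y hy p hp)))
    rw [hgA hy] at hd ⊢
    have : G y = g y - h p := by
      simp only [G]
      rw [min_eq_left hd.2, max_eq_right hd.1]
    rw [this, sub_self]
  have hc := isBddLipschitz_const (U := U) (h p)
  filter_upwards [D.ae_eq_zero_of_eq_zero ((hh.sub hc).sub hGB), D.ae_sub (hh.sub hc) hGB,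
    D.ae_sub hh hc, D.ae_const (h p), D.bound G hGB] with x h0 h1 h2 h3 h4 hx
  have h5 := h0 (hGA x hx)
  rw [h1, h2, h3, sub_zero, sub_eq_zero] at h5
  rw [h5]
  refine h4.trans (mul_le_mul_of_nonneg_left ?_ D.C_nonneg)
  simpa using lipNorm_le K.2 hGlip hGbd

/-- If `f` agrees with `∑ j, a j z • g j` to first order at almost every `z`, then
`D f = ∑ j, a j • D (g j)` almost everywhere. -/
theorem ae_eq_sum_of_bigLip_eq_zero [SecondCountableTopology U] {ι : Type*} [Fintype ι]
    {g : ι → U → ℝ} (hg : ∀ j, IsBddLipschitz (g j)) {f : U → ℝ} (hf : IsBddLipschitz f)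
    (a : ι → U → ℝ)
    (hchart : ∀ᵐ z ∂ν, bigLip (fun y => f y - ∑ j, a j z * g j y) z = 0) :
    ∀ᵐ z ∂ν, D.D f z = ∑ j, a j z * D.D (g j) z := by
  rcases isEmpty_or_nonempty U with hU | hU
  · exact Eventually.of_forall fun z => isEmptyElim z
  choose L hL using fun j => (hg j).1
  have hbd : ∀ᵐ z ∂ν, ∀ j, |D.D (g j) z| ≤ D.C * lipNorm (g j) :=
    ae_all_iff.2 fun j => D.bound _ (hg j)
  have main : ∀ ε : ℝ≥0, 0 < ε → ∀ᵐ z ∂ν, |D.D f z - ∑ j, a j z * D.D (g j) z| ≤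
      ε * (D.C * (1 + ∑ j, (L j : ℝ)) + ∑ j, D.C * lipNorm (g j)) := fun ε hε => by
    let r : ℕ → ℝ := fun n => 1 / ((n : ℝ) + 1)
    let A : ℕ × ℕ × ℕ → Set U := fun i =>
      {z | (∀ y, dist y z < r i.1 → |(f z - ∑ j, a j z * g j z) - (f y - ∑ j, a j z * g j y)| ≤
          ε * dist y z) ∧ dist (fun j => a j z) (TopologicalSpace.denseSeq (ι → ℝ) i.2.1) < ε ∧
        dist z (TopologicalSpace.denseSeq U i.2.2) < r i.1 / 2}
    have hpiece : ∀ i, ∀ᵐ z ∂ν, z ∈ A i →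
        |D.D f z - ∑ j, TopologicalSpace.denseSeq (ι → ℝ) i.2.1 j * D.D (g j) z| ≤
          D.C * (ε * (1 + ∑ j, (L j : ℝ))) := fun i => by
      let c := TopologicalSpace.denseSeq (ι → ℝ) i.2.1
      have hs := IsBddLipschitz.sum_mul Finset.univ hg c
      have hr1 : r i.1 ≤ 1 := by
        rw [div_le_one (by positivity)]; linarith [i.1.cast_nonneg (α := ℝ)]
      have hdist : ∀ x ∈ A i, ∀ y ∈ A i, dist x y < r i.1 := by
        rintro x ⟨-, -, hp⟩ y ⟨-, -, hq⟩
        linarith [dist_triangle_right x y (TopologicalSpace.denseSeq U i.2.2)]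
      have hA : LipschitzOnWith (ε * (1 + ∑ j, L j)) (fun y => f y - ∑ j, c j * g j y) (A i) := by
        refine LipschitzOnWith.of_dist_le_mul fun x hx y hy => ?_
        have h1 := hx.1 y (by rw [dist_comm]; exact hdist x hx y hy)
        have h2 : |∑ j, (a j x - c j) * (g j x - g j y)| ≤ ∑ j, ε * (L j * dist x y) := by
          refine (Finset.abs_sum_le_sum_abs _ _).trans (Finset.sum_le_sum fun j _ => ?_)
          rw [abs_mul]
          refine mul_le_mul ?_ ?_ (abs_nonneg _) ε.2
          · exact (Real.dist_eq _ _ ▸ dist_le_pi_dist (fun j => a j x) c j).trans hx.2.1.le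
          · exact Real.dist_eq _ _ ▸ (hL j).dist_le_mul x y
        have h3 : (f x - ∑ j, c j * g j x) - (f y - ∑ j, c j * g j y) =
            ((f x - ∑ j, a j x * g j x) - (f y - ∑ j, a j x * g j y)) +
              ∑ j, (a j x - c j) * (g j x - g j y) := by
          simp only [sub_mul, mul_sub, Finset.sum_sub_distrib]
          ring
        rw [Real.dist_eq, h3]
        refine (abs_add_le _ _).trans ((add_le_add h1 h2).trans_eq ?_)
        rw [← Finset.mul_sum, ← Finset.sum_mul, dist_comm y x]
        push_cast
        ring
      filter_upwards [D.ae_abs_le_of_lipschitzOn (hf.sub hs) hA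
        fun x hx y hy => (hdist x hx y hy).le.trans hr1, D.ae_sub hf hs,
        D.ae_sum_mul Finset.univ hg c] with z h1 h2 h3 hz
      have h4 := h1 hz
      rw [h2, h3] at h4
      simpa using h4
    filter_upwards [ae_all_iff.2 hpiece, hchart, hbd] with z hp hz hb
    obtain ⟨ρ, hρ, hz⟩ := exists_radius_of_bigLip_eq_zero
      (hf.sub (IsBddLipschitz.sum_mul Finset.univ hg fun j => a j z)) hz (NNReal.coe_pos.2 hε)
    obtain ⟨n, hn⟩ := exists_nat_one_div_lt hρ
    obtain ⟨k, hk⟩ := (TopologicalSpace.denseRange_denseSeq (ι → ℝ)).exists_dist_lt (fun j => a j z)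
      (NNReal.coe_pos.2 hε)
    obtain ⟨m, hm⟩ := (TopologicalSpace.denseRange_denseSeq U).exists_dist_lt z
      (half_pos (Nat.one_div_pos_of_nat (α := ℝ) (n := n)))
    have h1 := hp (n, k, m) ⟨fun y hy => hz y (hy.trans hn), hk, hm⟩
    have h2 : |∑ j, (TopologicalSpace.denseSeq (ι → ℝ) k j - a j z) * D.D (g j) z| ≤
        ∑ j, ε * (D.C * lipNorm (g j)) := by
      refine (Finset.abs_sum_le_sum_abs _ _).trans (Finset.sum_le_sum fun j _ => ?_)
      rw [abs_mul]
      refine mul_le_mul ?_ (hb j) (abs_nonneg _) ε.2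
      rw [abs_sub_comm]
      exact (Real.dist_eq _ _ ▸ dist_le_pi_dist (fun j => a j z) _ j).trans hk.le
    have h3 : D.D f z - ∑ j, a j z * D.D (g j) z =
        (D.D f z - ∑ j, TopologicalSpace.denseSeq (ι → ℝ) k j * D.D (g j) z) +
          ∑ j, (TopologicalSpace.denseSeq (ι → ℝ) k j - a j z) * D.D (g j) z := by
      simp only [sub_mul, Finset.sum_sub_distrib]
      ring
    rw [h3]
    refine (abs_add_le _ _).trans ((add_le_add h1 h2).trans_eq ?_)
    rw [← Finset.mul_sum]
    ring
  have hall : ∀ᵐ z ∂ν, ∀ n : ℕ, |D.D f z - ∑ j, a j z * D.D (g j) z| ≤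
      (1 / ((n : ℝ) + 1)) * (D.C * (1 + ∑ j, (L j : ℝ)) + ∑ j, D.C * lipNorm (g j)) :=
    ae_all_iff.2 fun n => by
      simpa using main (1 / ((n : ℝ≥0) + 1)) (by positivity)
  filter_upwards [hall] with z hz
  have hlim := (tendsto_one_div_add_atTop_nhds_zero_nat (𝕜 := ℝ)).mul_const
    (D.C * (1 + ∑ j, (L j : ℝ)) + ∑ j, D.C * lipNorm (g j))
  rw [zero_mul] at hlim
  exact sub_eq_zero.1 (abs_nonpos_iff.1 (ge_of_tendsto' hlim hz))

end MDerivation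

/-! ### Measures that are positive and finite on balls -/

section Balls

variable {X : Type*} [PseudoMetricSpace X] [MeasurableSpace X] {μ : Measure X}

lemma sigmaFinite_of_ball_lt_top [Nonempty X]
    (hfin : ∀ (x : X) (r : ℝ), 0 < r → μ (ball x r) < ⊤) : SigmaFinite μ := by
  obtain ⟨p⟩ := ‹Nonempty X›
  refine ⟨⟨⟨fun n => ball p ((n : ℝ) + 1), fun _ => trivial,
    fun n => hfin p _ (by positivity), eq_univ_of_forall fun x => ?_⟩⟩⟩
  obtain ⟨n, hn⟩ := exists_nat_gt (dist x p)
  exact mem_iUnion.2 ⟨n, by rw [mem_ball]; linarith⟩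

lemma secondCountable_of_ball_pos [OpensMeasurableSpace X] [SigmaFinite μ]
    (hpos : ∀ (x : X) (r : ℝ), 0 < r → 0 < μ (ball x r)) : SecondCountableTopology X := by
  refine Metric.secondCountable_of_almost_dense_set fun ε hε => ?_
  obtain ⟨t, ht⟩ := zorn_subset {t : Set X | t.Pairwise fun x y => ε ≤ dist x y}
    fun c hc hchain => ⟨⋃₀ c, (pairwise_sUnion hchain.directedOn).2 fun s hs => hc hs,
      fun s hs => subset_sUnion_of_mem hs⟩
  have htp : t.Pairwise fun x y => ε ≤ dist x y := ht.prop
  refine ⟨t, ?_, fun x => ?_⟩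
  · have hcount := Measure.countable_meas_pos_of_disjoint_iUnion (μ := μ)
      (As := fun x : t => ball (x : X) (ε / 2)) (fun _ => measurableSet_ball) fun x y hxy =>
        ball_disjoint_ball (by linarith [htp x.2 y.2 (Subtype.coe_ne_coe.2 hxy)])
    have huniv : {x : t | 0 < μ (ball (x : X) (ε / 2))} = univ :=
      eq_univ_of_forall fun x => hpos _ _ (half_pos hε)
    rw [huniv, countable_univ_iff] at hcount
    exact countable_coe_iff.1 hcount
  · by_contra! hx
    have hins : insert x t ∈ {t : Set X | t.Pairwise fun x y => ε ≤ dist x y} :=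
      htp.insert fun y hy _ => ⟨(hx y hy).le, by rw [dist_comm]; exact (hx y hy).le⟩
    have hxt : x ∈ t := ht.le_of_ge hins (subset_insert x t) (mem_insert x t)
    have := hx x hxt
    rw [dist_self] at this
    exact absurd this hε.not_gt

end Balls

lemma sigmaFinite_subMeasure {X : Type*} [MeasurableSpace X] {μ : Measure X} [SigmaFinite μ]
    {s : Set X} (hs : MeasurableSet s) : SigmaFinite (subMeasure μ s) := by
  refine SigmaFinite.of_map _ measurable_subtype_coe.aemeasurable ?_
  rw [subMeasure, map_comap_subtype_coe hs]
  infer_instance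

theorem stmt_15 {X : Type*} [MetricSpace X] [CompleteSpace X]
    [MeasurableSpace X] [BorelSpace X] (μ : Measure X) (hμ : μ ≠ 0)
    (hpos : ∀ (x : X) (r : ℝ), 0 < r → 0 < μ (ball x r))
    (hfin : ∀ (x : X) (r : ℝ), 0 < r → μ (ball x r) < ⊤)
    (CD : ℝ≥0∞) (hCD : 1 ≤ CD)
    (hdoub : ∀ (x : X) (r : ℝ), 0 < r → μ (ball x (2 * r)) ≤ CD * μ (ball x r))
    (Xα : Set X) (hXα : MeasurableSet Xα) (hXαpos : 0 < μ Xα)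
    {N : ℕ} (xs : Fin N → Xα → ℝ) (hxs : ∀ j, IsBddLipschitz (xs j))
    (D : MDerivation Xα (subMeasure μ Xα))
    (f : Xα → ℝ) (hf : IsBddLipschitz f)
    (a : Fin N → Xα → ℝ) (ha : ∀ j, Measurable (a j))
    (habdd : ∀ j, ∃ B : ℝ, ∀ᵐ z ∂(subMeasure μ Xα), |a j z| ≤ B)
    (hchart : ∀ᵐ z ∂(subMeasure μ Xα),
      bigLip (fun y => f y - ∑ j, a j z * xs j y) z = 0) :
    ∀ᵐ z ∂(subMeasure μ Xα), D.D f z = ∑ j, a j z * D.D (xs j) z := by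
  have : Nonempty X := ⟨(nonempty_of_measure_ne_zero hXαpos.ne').some⟩
  have : SigmaFinite μ := sigmaFinite_of_ball_lt_top hfin
  have : SecondCountableTopology X := secondCountable_of_ball_pos hpos
  have : SigmaFinite (subMeasure μ Xα) := sigmaFinite_subMeasure hXα
  exact D.ae_eq_sum_of_bigLip_eq_zero hxs hf a hchart
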